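/- Let 1 ≤ p < ∞. There exists a constant C > 0 depending only on d and p such that for every ε > 0, every h ∈ ℝ^d and every continuously differentiable compactly supported φ : ℝ^d → ℝ: the function e := ∇E_ε(h)[φ] − ∇φ vanishes outside the ball B_{(7/4)ε}(h) and satisfies ‖e‖_{L^p(ℝ^d)} ≤ C ‖∇φ‖_{L^p(B_{(7/4)ε}(h))}; in particular ‖E_ε(h)[φ]‖_{W^{1,p}(ℝ^d)} ≤ C' ‖φ‖_{W^{1,p}(ℝ^d)} with C' independent of ε and h. -/

import Mathlib

open MeasureTheory Metric Filter
open scoped ENNReal RealInnerProductSpace Topology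

/-- The restriction operator `E_ε(h)[φ]` of the paper. -/
noncomputable def Eop (d : ℕ) (H : ℝ → ℝ) (ε : ℝ) (h : EuclideanSpace ℝ (Fin d))
    (φ : EuclideanSpace ℝ (Fin d) → ℝ) (x : EuclideanSpace ℝ (Fin d)) : ℝ :=
  (⨍ y in closedBall h ε, φ y) * H (2 - ‖x - h‖ / ε) + φ x * H (‖x - h‖ / ε - 1)


/-- Jensen's inequality for `t ↦ t ^ q` and a probability measure. -/
lemma enorm_integral_rpow_le_lintegral {α : Type*} [MeasurableSpace α] {ν : Measure α}
    [IsProbabilityMeasure ν] {q : ℝ} (hq : 1 ≤ q) {f : α → ℝ} (hf : AEStronglyMeasurable f ν) :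
    ‖∫ a, f a ∂ν‖ₑ ^ q ≤ ∫⁻ a, ‖f a‖ₑ ^ q ∂ν := by
  have hq0 : 0 < q := by linarith
  have h := eLpNorm_le_eLpNorm_of_exponent_le (p := 1) (q := ENNReal.ofReal q)
    (by simpa using hq) hf
  rw [eLpNorm_one_eq_lintegral_enorm, eLpNorm_eq_lintegral_rpow_enorm_toReal (by simpa using hq0)
    (by simp), ENNReal.toReal_ofReal hq0.le] at h
  calc ‖∫ a, f a ∂ν‖ₑ ^ q ≤ (∫⁻ a, ‖f a‖ₑ ∂ν) ^ q := by
        gcongr; exact enorm_integral_le_lintegral_enorm f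
    _ ≤ ((∫⁻ a, ‖f a‖ₑ ^ q ∂ν) ^ (1 / q)) ^ q := by gcongr
    _ = ∫⁻ a, ‖f a‖ₑ ^ q ∂ν := by
        rw [← ENNReal.rpow_mul, one_div_mul_cancel hq0.ne', ENNReal.rpow_one]

/-- Jensen's inequality for the average over a set. -/
lemma enorm_setAverage_rpow_le {α : Type*} [MeasurableSpace α] {μ : Measure α} {s : Set α}
    (hs0 : μ s ≠ 0) (hs : μ s ≠ ∞) {q : ℝ} (hq : 1 ≤ q) {f : α → ℝ}
    (hf : AEStronglyMeasurable f (μ.restrict s)) :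
    ‖⨍ a in s, f a ∂μ‖ₑ ^ q ≤ (μ s)⁻¹ * ∫⁻ a in s, ‖f a‖ₑ ^ q ∂μ := by
  have : IsFiniteMeasure (μ.restrict s) := ⟨by simpa using hs.lt_top⟩
  have : NeZero (μ.restrict s) := ⟨by simpa using hs0⟩
  rw [average_eq']
  refine (enorm_integral_rpow_le_lintegral hq (hf.smul_measure _)).trans ?_
  rw [lintegral_smul_measure, Measure.restrict_apply_univ, smul_eq_mul]

section Poincare

variable {E : Type*} [NormedAddCommGroup E] [NormedSpace ℝ E]

/-- The fundamental theorem of calculus along a segment, in `L^q` form. -/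
lemma enorm_sub_rpow_le_lintegral_fderiv {φ : E → ℝ} (hφ : ContDiff ℝ 1 φ) {q : ℝ} (hq : 1 ≤ q)
    (x y : E) :
    ‖φ x - φ y‖ₑ ^ q ≤ ‖x - y‖ₑ ^ q *
      ∫⁻ t in Set.Icc (0 : ℝ) 1, ‖fderiv ℝ φ (y + t • (x - y))‖ₑ ^ q := by
  have hq0 : 0 ≤ q := by linarith
  have hc : Continuous (fderiv ℝ φ) := hφ.continuous_fderiv (by norm_num)
  have hl : Continuous fun t : ℝ => y + t • (x - y) := by fun_prop
  have hder (t : ℝ) : HasDerivAt (fun t : ℝ => φ (y + t • (x - y)))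
      (fderiv ℝ φ (y + t • (x - y)) (x - y)) t := by
    have h1 : HasDerivAt (fun t : ℝ => y + t • (x - y)) (x - y) t := by
      simpa using ((hasDerivAt_id t).smul_const (x - y)).const_add y
    exact ((hφ.differentiable (by norm_num) _).hasFDerivAt).comp_hasDerivAt t h1
  have hcont : Continuous fun t : ℝ => fderiv ℝ φ (y + t • (x - y)) (x - y) :=
    (hc.comp hl).clm_apply continuous_const
  have hftc := intervalIntegral.integral_eq_sub_of_hasDerivAt (a := 0) (b := 1)
    (fun t _ => hder t) (hcont.intervalIntegrable _ _)
  rw [intervalIntegral.integral_of_le zero_le_one, ← integral_Icc_eq_integral_Ioc] at hftc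
  simp only [one_smul, zero_smul, add_zero, add_sub_cancel] at hftc
  have : IsProbabilityMeasure (volume.restrict (Set.Icc (0 : ℝ) 1)) := ⟨by simp⟩
  rw [← hftc]
  refine (enorm_integral_rpow_le_lintegral hq hcont.aestronglyMeasurable).trans ?_
  have hmeas : Measurable fun t : ℝ => ‖fderiv ℝ φ (y + t • (x - y))‖ₑ ^ q :=
    (hc.comp hl).measurable.enorm.pow_const q
  rw [← lintegral_const_mul _ hmeas]
  gcongr with t
  rw [← ENNReal.mul_rpow_of_nonneg _ _ hq0, mul_comm]
  gcongr
  exact ContinuousLinearMap.le_opENorm _ _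

variable [FiniteDimensional ℝ E] [MeasurableSpace E] [BorelSpace E]
  (μ : Measure E) [μ.IsAddHaarMeasure]

/-- Change of variables under a contraction of ratio at least `1 / 2` mapping `s` to itself. -/
lemma setLIntegral_comp_add_smul_le {s : Set E} (hs : MeasurableSet s) {g : E → ℝ≥0∞}
    (hg : Measurable g) {c : ℝ} (hc : 1 / 2 ≤ c) (a : E) (hmaps : ∀ x ∈ s, a + c • x ∈ s) :
    ∫⁻ x in s, g (a + c • x) ∂μ ≤ 2 ^ Module.finrank ℝ E * ∫⁻ x in s, g x ∂μ := by
  have hc0 : 0 < c := by linarith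
  have hind : Measurable (s.indicator g) := hg.indicator hs
  calc ∫⁻ x in s, g (a + c • x) ∂μ ≤ ∫⁻ x, s.indicator g (a + c • x) ∂μ := by
        rw [← lintegral_indicator hs]
        refine lintegral_mono fun x => ?_
        by_cases hx : x ∈ s
        · simp [hx, hmaps x hx]
        · simp [hx]
    _ = ∫⁻ y, s.indicator g (a + y) ∂(Measure.map (c • ·) μ) := by
        rw [lintegral_map (by fun_prop) (by fun_prop)]
    _ = ENNReal.ofReal (|(c ^ Module.finrank ℝ E)⁻¹|) * ∫⁻ x in s, g x ∂μ := by
        rw [Measure.map_addHaar_smul μ hc0.ne', lintegral_smul_measure,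
          lintegral_add_left_eq_self, lintegral_indicator hs, smul_eq_mul]
    _ ≤ 2 ^ Module.finrank ℝ E * ∫⁻ x in s, g x ∂μ := by
        gcongr
        rw [abs_of_pos (by positivity), ← inv_pow, ENNReal.ofReal_pow (by positivity)]
        gcongr
        rw [← ENNReal.ofReal_ofNat 2]
        gcongr
        rw [inv_le_comm₀ hc0 (by norm_num)]
        linarith

/-- A function averaged over the segments between points of a convex set. -/
lemma setLIntegral_setLIntegral_segment_le {s : Set E} (hs : MeasurableSet s) (hconv : Convex ℝ s)
    {g : E → ℝ≥0∞} (hg : Measurable g) :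
    ∫⁻ x in s, ∫⁻ y in s, (∫⁻ t in Set.Icc (0 : ℝ) 1, g (y + t • (x - y))) ∂μ ∂μ ≤
      2 ^ Module.finrank ℝ E * μ s * ∫⁻ x in s, g x ∂μ := by
  have key (t : ℝ) (ht : t ∈ Set.Icc (0 : ℝ) 1) :
      ∫⁻ x in s, ∫⁻ y in s, g (y + t • (x - y)) ∂μ ∂μ ≤
        2 ^ Module.finrank ℝ E * μ s * ∫⁻ x in s, g x ∂μ := by
    have hrw (x y : E) : y + t • (x - y) = (1 - t) • y + t • x := by module
    have hconst (K : ℝ≥0∞) : ∫⁻ _ in s, 2 ^ Module.finrank ℝ E * K ∂μ =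
        2 ^ Module.finrank ℝ E * μ s * K := by
      rw [setLIntegral_const]; ring
    rcases le_total t (1 / 2) with h | h
    · rw [← hconst]
      refine setLIntegral_mono' hs fun x hx => ?_
      simp_rw [hrw, add_comm _ (t • x)]
      refine setLIntegral_comp_add_smul_le μ hs hg (by linarith) _ fun y hy => ?_
      exact hconv hx hy ht.1 (by linarith [ht.2]) (by ring)
    · rw [lintegral_lintegral_swap (by fun_prop), ← hconst]
      refine setLIntegral_mono' hs fun y hy => ?_
      simp_rw [hrw]
      refine setLIntegral_comp_add_smul_le μ hs hg h _ fun x hx => ?_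
      exact hconv hy hx (by linarith [ht.2]) ht.1 (by ring)
  have hswap : ∫⁻ x in s, ∫⁻ y in s, (∫⁻ t in Set.Icc (0 : ℝ) 1, g (y + t • (x - y))) ∂μ ∂μ =
      ∫⁻ t in Set.Icc (0 : ℝ) 1, ∫⁻ x in s, ∫⁻ y in s, g (y + t • (x - y)) ∂μ ∂μ := by
    have hinner (x : E) : ∫⁻ y in s, (∫⁻ t in Set.Icc (0 : ℝ) 1, g (y + t • (x - y))) ∂μ =
        ∫⁻ t in Set.Icc (0 : ℝ) 1, ∫⁻ y in s, g (y + t • (x - y)) ∂μ :=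
      lintegral_lintegral_swap (by fun_prop)
    simp_rw [hinner]
    refine lintegral_lintegral_swap (Measurable.aemeasurable ?_)
    have : Measurable fun z : (E × ℝ) × E => g (z.2 + z.1.2 • (z.1.1 - z.2)) := by fun_prop
    exact this.lintegral_prod_right'
  rw [hswap]
  refine (setLIntegral_mono' measurableSet_Icc key).trans ?_
  rw [setLIntegral_const]
  simp

/-- Ratio of the measures of concentric balls. -/
lemma inv_measure_closedBall_mul (h : E) {r R : ℝ} (hr : 0 < r) (hR : 0 ≤ R) :
    (μ (closedBall h r))⁻¹ * μ (closedBall h R) =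
      ENNReal.ofReal ((R / r) ^ Module.finrank ℝ E) := by
  rw [mul_comm, ← div_eq_mul_inv, Measure.addHaar_closedBall μ h hr.le,
    Measure.addHaar_closedBall μ h hR, ENNReal.mul_div_mul_right _ _
      (measure_ball_pos μ _ one_pos).ne' measure_ball_lt_top.ne,
    ← ENNReal.ofReal_div_of_pos (by positivity), div_pow]

/-- Poincaré's inequality on a ball, with the average taken over a smaller concentric ball. -/
lemma lintegral_enorm_sub_setAverage_rpow_le {φ : E → ℝ} (hφ : ContDiff ℝ 1 φ) {q : ℝ}
    (hq : 1 ≤ q) (h : E) {r R : ℝ} (hr : 0 < r) (hrR : r ≤ R) :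
    ∫⁻ x in closedBall h R, ‖φ x - ⨍ y in closedBall h r, φ y ∂μ‖ₑ ^ q ∂μ ≤
      ENNReal.ofReal (2 * R) ^ q * (2 ^ Module.finrank ℝ E *
        ENNReal.ofReal ((R / r) ^ Module.finrank ℝ E)) *
        ∫⁻ x in closedBall h R, ‖fderiv ℝ φ x‖ₑ ^ q ∂μ := by
  have hq0 : 0 ≤ q := by linarith
  have hR : 0 < R := by linarith
  have hv0 : μ (closedBall h r) ≠ 0 := (measure_closedBall_pos μ h hr).ne'
  have hv : μ (closedBall h r) ≠ ∞ := measure_closedBall_lt_top.ne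
  have hφc := hφ.continuous
  have hc : Continuous (fderiv ℝ φ) := hφ.continuous_fderiv (by norm_num)
  have hjensen (x : E) : ‖φ x - ⨍ y in closedBall h r, φ y ∂μ‖ₑ ^ q ≤
      (μ (closedBall h r))⁻¹ * ∫⁻ y in closedBall h r, ‖φ x - φ y‖ₑ ^ q ∂μ := by
    have hint : IntegrableOn φ (closedBall h r) μ :=
      hφc.continuousOn.integrableOn_compact (isCompact_closedBall h r)
    have hcst : IntegrableOn (fun _ => φ x) (closedBall h r) μ := integrableOn_const hv
    have heq : φ x - ⨍ y in closedBall h r, φ y ∂μ = ⨍ y in closedBall h r, (φ x - φ y) ∂μ := by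
      have hreal : μ.real (closedBall h r) ≠ 0 := by
        simp [measureReal_def, ENNReal.toReal_eq_zero_iff, hv0, hv]
      rw [setAverage_eq, setAverage_eq, integral_sub hcst hint,
        setIntegral_const, smul_sub, inv_smul_smul₀ hreal]
    rw [heq]
    exact enorm_setAverage_rpow_le hv0 hv hq (by fun_prop)
  have hratio := inv_measure_closedBall_mul μ h hr hR.le
  calc _ ≤ ∫⁻ x in closedBall h R, (μ (closedBall h r))⁻¹ * ∫⁻ y in closedBall h R,
          ENNReal.ofReal (2 * R) ^ q * (∫⁻ t in Set.Icc (0 : ℝ) 1,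
            ‖fderiv ℝ φ (y + t • (x - y))‖ₑ ^ q) ∂μ ∂μ := by
        refine setLIntegral_mono' measurableSet_closedBall fun x hx => (hjensen x).trans ?_
        refine mul_le_mul' le_rfl ?_
        refine (lintegral_mono_set (closedBall_subset_closedBall (x := h) hrR)).trans ?_
        refine setLIntegral_mono' measurableSet_closedBall fun y hy =>
          (enorm_sub_rpow_le_lintegral_fderiv hφ hq x y).trans ?_
        gcongr
        rw [← ofReal_norm, ← dist_eq_norm]
        refine ENNReal.ofReal_le_ofReal ((dist_triangle_right x y h).trans ?_)
        linarith [mem_closedBall.1 hx, mem_closedBall.1 hy]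
    _ = (μ (closedBall h r))⁻¹ * (ENNReal.ofReal (2 * R) ^ q * ∫⁻ x in closedBall h R,
          ∫⁻ y in closedBall h R, (∫⁻ t in Set.Icc (0 : ℝ) 1,
            ‖fderiv ℝ φ (y + t • (x - y))‖ₑ ^ q) ∂μ ∂μ) := by
        rw [lintegral_const_mul' _ _ (ENNReal.inv_ne_top.2 hv0)]
        simp_rw [lintegral_const_mul' _ _ (ENNReal.rpow_ne_top_of_nonneg hq0 ENNReal.ofReal_ne_top)]
    _ ≤ (μ (closedBall h r))⁻¹ * (ENNReal.ofReal (2 * R) ^ q *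
          (2 ^ Module.finrank ℝ E * μ (closedBall h R) *
            ∫⁻ x in closedBall h R, ‖fderiv ℝ φ x‖ₑ ^ q ∂μ)) := by
        gcongr
        exact setLIntegral_setLIntegral_segment_le μ measurableSet_closedBall
          (convex_closedBall h R) (g := fun z => ‖fderiv ℝ φ z‖ₑ ^ q)
          (hc.measurable.enorm.pow_const q)
    _ = _ := by rw [← hratio]; ring

/-- Poincaré's inequality on a ball, with the average taken over a smaller concentric ball. -/
lemma eLpNorm_sub_setAverage_le {φ : E → ℝ} (hφ : ContDiff ℝ 1 φ) {p : ℝ≥0∞} (hp1 : 1 ≤ p)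
    (hp2 : p ≠ ∞) (h : E) {r R : ℝ} (hr : 0 < r) (hrR : r ≤ R) :
    eLpNorm (fun x => φ x - ⨍ y in closedBall h r, φ y ∂μ) p (μ.restrict (closedBall h R)) ≤
      ENNReal.ofReal (2 * R) * (2 ^ Module.finrank ℝ E *
        ENNReal.ofReal ((R / r) ^ Module.finrank ℝ E)) ^ (1 / p.toReal) *
        eLpNorm (fderiv ℝ φ) p (μ.restrict (closedBall h R)) := by
  have hp0 : p ≠ 0 := (zero_lt_one.trans_le hp1).ne'
  have hq : 1 ≤ p.toReal := by simpa using (ENNReal.toReal_le_toReal ENNReal.one_ne_top hp2).2 hp1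
  have hq0 : 0 < p.toReal := by linarith
  rw [eLpNorm_eq_lintegral_rpow_enorm_toReal hp0 hp2, eLpNorm_eq_lintegral_rpow_enorm_toReal hp0 hp2]
  have hle := ENNReal.rpow_le_rpow (z := 1 / p.toReal)
    (lintegral_enorm_sub_setAverage_rpow_le μ hφ hq h hr hrR) (by positivity)
  refine hle.trans_eq ?_
  rw [ENNReal.mul_rpow_of_nonneg _ _ (by positivity), ENNReal.mul_rpow_of_nonneg _ _ (by positivity),
    ← ENNReal.rpow_mul, mul_one_div_cancel hq0.ne', ENNReal.rpow_one]

/-- The average over a ball, as a constant function on a concentric ball, is controlled in `L^p`. -/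
lemma eLpNorm_setAverage_le {φ : E → ℝ} (hφ : Continuous φ) {p : ℝ≥0∞} (hp1 : 1 ≤ p)
    (hp2 : p ≠ ∞) (h : E) {r R : ℝ} (hr : 0 < r) (hR : 0 ≤ R) :
    eLpNorm (fun _ => ⨍ y in closedBall h r, φ y ∂μ) p (μ.restrict (closedBall h R)) ≤
      ENNReal.ofReal ((R / r) ^ Module.finrank ℝ E) ^ (1 / p.toReal) * eLpNorm φ p μ := by
  have hp0 : p ≠ 0 := (zero_lt_one.trans_le hp1).ne'
  have hq : 1 ≤ p.toReal := by simpa using (ENNReal.toReal_le_toReal ENNReal.one_ne_top hp2).2 hp1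
  rw [eLpNorm_eq_lintegral_rpow_enorm_toReal hp0 hp2, eLpNorm_eq_lintegral_rpow_enorm_toReal hp0 hp2,
    setLIntegral_const, ← ENNReal.mul_rpow_of_nonneg _ _ (by positivity)]
  refine ENNReal.rpow_le_rpow ?_ (by positivity)
  calc _ ≤ ((μ (closedBall h r))⁻¹ * ∫⁻ y in closedBall h r, ‖φ y‖ₑ ^ p.toReal ∂μ) *
        μ (closedBall h R) := by
        gcongr
        exact enorm_setAverage_rpow_le (measure_closedBall_pos μ h hr).ne'
          measure_closedBall_lt_top.ne hq hφ.aestronglyMeasurable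
    _ ≤ ((μ (closedBall h r))⁻¹ * ∫⁻ y, ‖φ y‖ₑ ^ p.toReal ∂μ) * μ (closedBall h R) := by
        gcongr
        exact Measure.restrict_le_self
    _ = _ := by rw [← inv_measure_closedBall_mul μ h hr hR]; ring

end Poincare

section Cutoff

variable {H : ℝ → ℝ}

/-- A transition function with symmetric derivative is complementary to its reflection. -/
lemma add_apply_one_sub_eq_one (hH : Differentiable ℝ H)
    (hH0 : ∀ z : ℝ, z ≤ 1 / 4 → H z = 0) (hH1 : ∀ z : ℝ, 3 / 4 ≤ z → H z = 1)
    (hHsym : ∀ z : ℝ, deriv H z = deriv H (1 - z)) (z : ℝ) : H z + H (1 - z) = 1 := by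
  have hd (w : ℝ) : HasDerivAt (fun z => H z + H (1 - z)) 0 w := by
    have h1 := (hH (1 - w)).hasDerivAt.comp w ((hasDerivAt_id w).const_sub 1)
    have h2 := (hH w).hasDerivAt.add h1
    rw [hHsym w] at h2
    simpa using! h2
  have := is_const_of_deriv_eq_zero (fun w => (hd w).differentiableAt) (fun w => (hd w).deriv) z 0
  simpa [hH0 0 (by norm_num), hH1 1 (by norm_num)] using this

/-- A smooth transition function is Lipschitz. -/
lemma exists_lipschitzWith_of_transition (hH : ContDiff ℝ 1 H)
    (hH0 : ∀ z : ℝ, z ≤ 1 / 4 → H z = 0) (hH1 : ∀ z : ℝ, 3 / 4 ≤ z → H z = 1) :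
    ∃ M : NNReal, LipschitzWith M H := by
  have hsupp : HasCompactSupport (deriv H) := by
    refine HasCompactSupport.of_support_subset_isCompact (isCompact_Icc (a := (0 : ℝ)) (b := 1)) ?_
    intro z hz
    by_contra hmem
    apply hz
    rcases lt_or_ge z 0 with h | h
    · have : H =ᶠ[𝓝 z] fun _ => 0 := by
        filter_upwards [Iio_mem_nhds h] with w hw
        exact hH0 w (by linarith [Set.mem_Iio.1 hw])
      rw [this.deriv_eq, deriv_const]
    · have h1 : 1 < z := by
        by_contra h'
        exact hmem ⟨h, not_lt.1 h'⟩
      have : H =ᶠ[𝓝 z] fun _ => 1 := by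
        filter_upwards [Ioi_mem_nhds h1] with w hw
        exact hH1 w (by linarith [Set.mem_Ioi.1 hw])
      rw [this.deriv_eq, deriv_const]
  obtain ⟨M, hM⟩ := hsupp.exists_bound_of_continuous (hH.continuous_deriv le_rfl)
  refine ⟨M.toNNReal, lipschitzWith_of_nnnorm_deriv_le (hH.differentiable (by norm_num)) fun z => ?_⟩
  rw [← NNReal.coe_le_coe, coe_nnnorm]
  exact (hM z).trans (Real.le_coe_toNNReal M)

variable {E : Type*} [NormedAddCommGroup E]

/-- The radial cutoff built from a Lipschitz function is Lipschitz. -/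
lemma lipschitzWith_radial {M : NNReal} (hM : LipschitzWith M H) {ε : ℝ} (hε : 0 < ε) (h : E) :
    LipschitzWith (M * (Real.toNNReal ε)⁻¹) fun x => H (‖x - h‖ / ε - 1) := by
  refine LipschitzWith.of_dist_le_mul fun x y => (hM.dist_le_mul _ _).trans ?_
  rw [NNReal.coe_mul, NNReal.coe_inv, Real.coe_toNNReal _ hε.le, mul_assoc]
  gcongr
  rw [Real.dist_eq, sub_sub_sub_cancel_right, ← sub_div, abs_div, abs_of_pos hε, div_eq_inv_mul]
  gcongr
  refine (abs_norm_sub_norm_le _ _).trans_eq ?_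
  rw [sub_sub_sub_cancel_right, dist_eq_norm]

variable [InnerProductSpace ℝ E]

/-- The radial cutoff is differentiable. -/
lemma differentiable_radial (hH : Differentiable ℝ H) (hH0 : ∀ z : ℝ, z ≤ 1 / 4 → H z = 0)
    {ε : ℝ} (hε : 0 < ε) (h : E) : Differentiable ℝ fun x => H (‖x - h‖ / ε - 1) := by
  intro x
  rcases eq_or_ne x h with rfl | hx
  · have : (fun y => H (‖y - x‖ / ε - 1)) =ᶠ[𝓝 x] fun _ => 0 := by
      filter_upwards [ball_mem_nhds x hε] with y hy
      have : ‖y - x‖ / ε < 1 := (div_lt_one hε).2 (mem_ball_iff_norm.1 hy)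
      exact hH0 _ (by linarith)
    exact this.differentiableAt_iff.2 (differentiableAt_const 0)
  · have hn : DifferentiableAt ℝ (fun y => ‖y - h‖) x :=
      (differentiableAt_id.sub_const h).norm ℝ (sub_ne_zero.2 hx)
    have hdiv : DifferentiableAt ℝ (fun y => ‖y - h‖ / ε - 1) x := by
      simpa only [div_eq_mul_inv] using (hn.mul_const ε⁻¹).sub_const 1
    exact (hH _).comp x hdiv

end Cutoff

section Gradient

variable {E : Type*} [NormedAddCommGroup E] [InnerProductSpace ℝ E] [CompleteSpace E]

lemma norm_gradient_eq_norm_fderiv (f : E → ℝ) (x : E) : ‖gradient f x‖ = ‖fderiv ℝ f x‖ := by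
  simp [gradient]

lemma norm_gradient_sub_gradient (f g : E → ℝ) (x : E) :
    ‖gradient f x - gradient g x‖ = ‖fderiv ℝ f x - fderiv ℝ g x‖ := by
  rw [gradient, gradient, ← map_sub, LinearIsometryEquiv.norm_map]

lemma aestronglyMeasurable_gradient [FiniteDimensional ℝ E] [MeasurableSpace E] [BorelSpace E]
    (f : E → ℝ) (μ : Measure E) : AEStronglyMeasurable (gradient f) μ :=
  ((InnerProductSpace.toDual ℝ E).symm.continuous.measurable.comp
    (measurable_fderiv ℝ f)).aestronglyMeasurable

end Gradient

section Eop

variable {d : ℕ} {H : ℝ → ℝ}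

lemma Eop_eq_average_add (hHadd : ∀ z, H z + H (1 - z) = 1) (ε : ℝ)
    (h : EuclideanSpace ℝ (Fin d)) (φ : EuclideanSpace ℝ (Fin d) → ℝ) :
    Eop d H ε h φ = fun x => (⨍ y in closedBall h ε, φ y) +
      (φ x - ⨍ y in closedBall h ε, φ y) * H (‖x - h‖ / ε - 1) := by
  ext x
  have := hHadd (2 - ‖x - h‖ / ε)
  rw [show 1 - (2 - ‖x - h‖ / ε) = ‖x - h‖ / ε - 1 by ring] at this
  rw [Eop]
  linear_combination (⨍ y in closedBall h ε, φ y) * this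

/-- Outside `B_{(7/4)ε}(h)` the restriction operator does not change the function. -/
lemma Eop_eq_self_of_notMem (hH0 : ∀ z : ℝ, z ≤ 1 / 4 → H z = 0)
    (hH1 : ∀ z : ℝ, 3 / 4 ≤ z → H z = 1) {ε : ℝ} (hε : 0 < ε) {h x : EuclideanSpace ℝ (Fin d)}
    (φ : EuclideanSpace ℝ (Fin d) → ℝ) (hx : x ∉ closedBall h (7 / 4 * ε)) :
    Eop d H ε h φ x = φ x := by
  rw [mem_closedBall_iff_norm, not_le, ← lt_div_iff₀ hε] at hx
  rw [Eop, hH0 _ (by linarith), hH1 _ (by linarith)]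
  ring

lemma fderiv_Eop_of_notMem (hH0 : ∀ z : ℝ, z ≤ 1 / 4 → H z = 0)
    (hH1 : ∀ z : ℝ, 3 / 4 ≤ z → H z = 1) {ε : ℝ} (hε : 0 < ε) {h x : EuclideanSpace ℝ (Fin d)}
    (φ : EuclideanSpace ℝ (Fin d) → ℝ) (hx : x ∉ closedBall h (7 / 4 * ε)) :
    fderiv ℝ (Eop d H ε h φ) x = fderiv ℝ φ x := by
  refine Filter.EventuallyEq.fderiv_eq ?_
  filter_upwards [isClosed_closedBall.isOpen_compl.mem_nhds hx] with y hy
  exact Eop_eq_self_of_notMem hH0 hH1 hε φ hy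

/-- Pointwise bound for the gradient error. -/
lemma norm_fderiv_Eop_sub_le (hH : Differentiable ℝ H) (hH01 : ∀ z : ℝ, 0 ≤ H z ∧ H z ≤ 1)
    (hH0 : ∀ z : ℝ, z ≤ 1 / 4 → H z = 0) (hHadd : ∀ z, H z + H (1 - z) = 1)
    {M : NNReal} (hM : LipschitzWith M H) {ε : ℝ} (hε : 0 < ε) (h x : EuclideanSpace ℝ (Fin d))
    {φ : EuclideanSpace ℝ (Fin d) → ℝ} (hφ : DifferentiableAt ℝ φ x) :
    ‖fderiv ℝ (Eop d H ε h φ) x - fderiv ℝ φ x‖ ≤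
      ‖fderiv ℝ φ x‖ + M / ε * ‖φ x - ⨍ y in closedBall h ε, φ y‖ := by
  have hη := differentiable_radial hH hH0 hε h x
  have hder := ((hφ.hasFDerivAt.sub_const (⨍ y in closedBall h ε, φ y)).mul
    hη.hasFDerivAt).const_add (⨍ y in closedBall h ε, φ y)
  have hlip := norm_fderiv_le_of_lipschitz ℝ (x₀ := x) (lipschitzWith_radial hM hε h)
  rw [NNReal.coe_mul, NNReal.coe_inv, Real.coe_toNNReal _ hε.le, ← div_eq_mul_inv] at hlip
  rw [Eop_eq_average_add hHadd]
  erw [hder.fderiv]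
  set D := fderiv ℝ (fun x => H (‖x - h‖ / ε - 1)) x
  set s := H (‖x - h‖ / ε - 1)
  have hs1 : |s - 1| ≤ 1 := by
    rw [abs_le]
    constructor <;> linarith [(hH01 (‖x - h‖ / ε - 1)).1, (hH01 (‖x - h‖ / ε - 1)).2]
  calc _ = ‖(s - 1) • fderiv ℝ φ x + (φ x - ⨍ y in closedBall h ε, φ y) • D‖ := by
        congr 1; module
    _ ≤ |s - 1| * ‖fderiv ℝ φ x‖ + ‖φ x - ⨍ y in closedBall h ε, φ y‖ * ‖D‖ := by
        refine (norm_add_le _ _).trans_eq ?_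
        rw [norm_smul, norm_smul, Real.norm_eq_abs]
    _ ≤ 1 * ‖fderiv ℝ φ x‖ + ‖φ x - ⨍ y in closedBall h ε, φ y‖ * (M / ε) := by gcongr
    _ = _ := by ring

end Eop

/-- `W^{1,p}` estimates for the restriction operator: the gradient error vanishes outside
`B_{(7/4)ε}(h)` and is bounded in `L^p` by the `L^p` norm of `∇φ` on that ball; in
particular `E_ε(h)` is bounded on `W^{1,p}` uniformly in `ε` and `h`. -/
theorem stmt11 (d : ℕ) (hd : 2 ≤ d) (H : ℝ → ℝ) (hH : ContDiff ℝ (⊤ : ℕ∞) H)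
    (hH01 : ∀ z : ℝ, 0 ≤ H z ∧ H z ≤ 1)
    (hH0 : ∀ z : ℝ, z ≤ 1/4 → H z = 0)
    (hH1 : ∀ z : ℝ, 3/4 ≤ z → H z = 1)
    (hHsym : ∀ z : ℝ, deriv H z = deriv H (1 - z))
    (p : ℝ≥0∞) (hp1 : 1 ≤ p) (hp2 : p ≠ ⊤) :
    ∃ C C' : ℝ, 0 < C ∧ 0 < C' ∧
      ∀ (ε : ℝ), 0 < ε → ∀ (h : EuclideanSpace ℝ (Fin d))
        (φ : EuclideanSpace ℝ (Fin d) → ℝ), ContDiff ℝ 1 φ → HasCompactSupport φ →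
        (∀ x, x ∉ closedBall h (7/4 * ε) →
          gradient (Eop d H ε h φ) x - gradient φ x = 0) ∧
        eLpNorm (fun x => gradient (Eop d H ε h φ) x - gradient φ x) p volume ≤
          ENNReal.ofReal C *
            eLpNorm (gradient φ) p (volume.restrict (closedBall h (7/4 * ε))) ∧
        eLpNorm (Eop d H ε h φ) p volume + eLpNorm (gradient (Eop d H ε h φ)) p volume ≤
          ENNReal.ofReal C' * (eLpNorm φ p volume + eLpNorm (gradient φ) p volume) := by
  have hH1' : ContDiff ℝ 1 H := hH.of_le (by exact_mod_cast le_top)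
  have hHd : Differentiable ℝ H := hH1'.differentiable (by norm_num)
  have hHadd := add_apply_one_sub_eq_one hHd hH0 hH1 hHsym
  obtain ⟨M, hM⟩ := exists_lipschitzWith_of_transition hH1' hH0 hH1
  obtain ⟨K, hK⟩ : ∃ K : NNReal, (K : ℝ≥0∞) =
      (2 ^ d * ENNReal.ofReal ((7 / 4 : ℝ) ^ d)) ^ (1 / p.toReal) :=
    ⟨_, ENNReal.coe_toNNReal (ENNReal.rpow_ne_top_of_nonneg (by positivity)
      (ENNReal.mul_ne_top (by simp) ENNReal.ofReal_ne_top))⟩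
  obtain ⟨L, hL⟩ : ∃ L : NNReal, (L : ℝ≥0∞) =
      ENNReal.ofReal ((7 / 4 : ℝ) ^ d) ^ (1 / p.toReal) :=
    ⟨_, ENNReal.coe_toNNReal (ENNReal.rpow_ne_top_of_nonneg (by positivity)
      ENNReal.ofReal_ne_top)⟩
  refine ⟨1 + M * (7 / 2) * K, 2 + L + M * (7 / 2) * K, by positivity, by positivity, ?_⟩
  intro ε hε h φ hφ _
  have hr : ε ≤ 7 / 4 * ε := by linarith
  have hratio : 7 / 4 * ε / ε = 7 / 4 := by field_simp
  have hφc := hφ.continuous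
  have hDc : Continuous (fderiv ℝ φ) := hφ.continuous_fderiv (by norm_num)
  have hgrad (ν : Measure (EuclideanSpace ℝ (Fin d))) :
      eLpNorm (gradient φ) p ν = eLpNorm (fderiv ℝ φ) p ν :=
    eLpNorm_congr_norm_ae (.of_forall fun x => norm_gradient_eq_norm_fderiv φ x)
  have hzero (x) (hx : x ∉ closedBall h (7 / 4 * ε)) :
      gradient (Eop d H ε h φ) x - gradient φ x = 0 := by
    rw [gradient, gradient, fderiv_Eop_of_notMem hH0 hH1 hε φ hx, sub_self]
  set A := ⨍ y in closedBall h ε, φ y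
  set B := closedBall h (7 / 4 * ε)
  have hBm : MeasurableSet B := measurableSet_closedBall
  have hcoef : ENNReal.ofReal (M * (7 / 2) * K) =
      ENNReal.ofReal (M / ε) * (ENNReal.ofReal (2 * (7 / 4 * ε)) * K) := by
    rw [← ENNReal.ofReal_coe_nnreal (p := K), ← ENNReal.ofReal_mul (by positivity),
      ← ENNReal.ofReal_mul (by positivity)]
    congr 1
    field_simp
    ring
  have herr : eLpNorm (fun x => gradient (Eop d H ε h φ) x - gradient φ x) p volume ≤
      ENNReal.ofReal (1 + M * (7 / 2) * K) * eLpNorm (gradient φ) p (volume.restrict B) := by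
    calc _ ≤ eLpNorm (B.indicator fun x => ‖fderiv ℝ φ x‖ + M / ε * ‖φ x - A‖) p volume := by
          refine eLpNorm_mono_real fun x => ?_
          by_cases hx : x ∈ B
          · rw [Set.indicator_of_mem hx, norm_gradient_sub_gradient]
            exact norm_fderiv_Eop_sub_le hHd hH01 hH0 hHadd hM hε h x
              (hφ.differentiable (by norm_num) x)
          · rw [Set.indicator_of_notMem hx, hzero x hx, norm_zero]
      _ = eLpNorm ((fun x => ‖fderiv ℝ φ x‖) + (M / ε : ℝ) • fun x => ‖φ x - A‖) p
            (volume.restrict B) := eLpNorm_indicator_eq_eLpNorm_restrict hBm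
      _ ≤ eLpNorm (fderiv ℝ φ) p (volume.restrict B) + ENNReal.ofReal (M / ε) *
            eLpNorm (fun x => φ x - A) p (volume.restrict B) := by
          refine (eLpNorm_add_le hDc.norm.aestronglyMeasurable
            ((by fun_prop : Continuous fun x => ‖φ x - A‖).aestronglyMeasurable.const_smul _)
            hp1).trans_eq ?_
          rw [eLpNorm_const_smul, eLpNorm_norm, eLpNorm_norm,
            Real.enorm_eq_ofReal (by positivity)]
      _ ≤ eLpNorm (fderiv ℝ φ) p (volume.restrict B) + ENNReal.ofReal (M / ε) *
            (ENNReal.ofReal (2 * (7 / 4 * ε)) * K *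
              eLpNorm (fderiv ℝ φ) p (volume.restrict B)) := by
          gcongr
          have := eLpNorm_sub_setAverage_le volume hφ hp1 hp2 h hε hr
          rwa [hratio, finrank_euclideanSpace_fin, ← hK] at this
      _ = _ := by
          rw [hgrad, ENNReal.ofReal_add zero_le_one (by positivity), ENNReal.ofReal_one, add_mul,
            one_mul, hcoef, mul_assoc (ENNReal.ofReal (M / ε))]
  refine ⟨hzero, herr, ?_⟩
  have hE : eLpNorm (Eop d H ε h φ) p volume ≤ (1 + L) * eLpNorm φ p volume := by
    calc _ ≤ eLpNorm ((fun x => ‖φ x‖) + B.indicator fun _ => ‖A‖) p volume := by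
          refine eLpNorm_mono_real fun x => ?_
          by_cases hx : x ∈ B
          · rw [Pi.add_apply, Set.indicator_of_mem hx, Eop, add_comm]
            refine (norm_add_le _ _).trans ?_
            rw [norm_mul, norm_mul, Real.norm_of_nonneg (hH01 _).1, Real.norm_of_nonneg (hH01 _).1]
            exact add_le_add (mul_le_of_le_one_right (norm_nonneg _) (hH01 _).2)
              (mul_le_of_le_one_right (norm_nonneg _) (hH01 _).2)
          · rw [Pi.add_apply, Set.indicator_of_notMem hx, add_zero,
              Eop_eq_self_of_notMem hH0 hH1 hε φ hx]
      _ ≤ eLpNorm φ p volume + eLpNorm (fun _ => A) p (volume.restrict B) := by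
          refine (eLpNorm_add_le hφc.norm.aestronglyMeasurable
            (aestronglyMeasurable_const.indicator hBm) hp1).trans_eq ?_
          rw [eLpNorm_norm, eLpNorm_indicator_eq_eLpNorm_restrict hBm,
            eLpNorm_norm (fun _ : EuclideanSpace ℝ (Fin d) => A)]
      _ ≤ eLpNorm φ p volume + L * eLpNorm φ p volume := by
          gcongr
          have := eLpNorm_setAverage_le volume hφc hp1 hp2 h hε (R := 7 / 4 * ε) (by positivity)
          rwa [hratio, finrank_euclideanSpace_fin, ← hL] at this
      _ = _ := by rw [add_mul, one_mul]
  have hDE : eLpNorm (gradient (Eop d H ε h φ)) p volume ≤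
      (2 + ENNReal.ofReal (M * (7 / 2) * K)) * eLpNorm (gradient φ) p volume := by
    calc _ = eLpNorm (gradient φ + fun x => gradient (Eop d H ε h φ) x - gradient φ x) p
            volume := by
          congr 1; ext1 x; simp
      _ ≤ eLpNorm (gradient φ) p volume + ENNReal.ofReal (1 + M * (7 / 2) * K) *
            eLpNorm (gradient φ) p volume := by
          refine (eLpNorm_add_le (aestronglyMeasurable_gradient _ _)
            ((aestronglyMeasurable_gradient _ _).sub (aestronglyMeasurable_gradient _ _))
            hp1).trans ?_
          gcongr
          refine herr.trans ?_
          gcongr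
          exact Measure.restrict_le_self
      _ = _ := by
          rw [ENNReal.ofReal_add zero_le_one (by positivity), ENNReal.ofReal_one, ← one_add_mul,
            ← add_assoc, one_add_one_eq_two]
  have hC' : ENNReal.ofReal (2 + L + M * (7 / 2) * K) =
      2 + L + ENNReal.ofReal (M * (7 / 2) * K) := by
    rw [ENNReal.ofReal_add (by positivity) (by positivity), ENNReal.ofReal_add (by positivity)
      (by positivity), ENNReal.ofReal_ofNat, ENNReal.ofReal_coe_nnreal]
  rw [hC', mul_add]
  refine add_le_add (hE.trans ?_) (hDE.trans ?_)
  · refine mul_le_mul' ?_ le_rfl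
    exact (add_le_add one_le_two le_rfl).trans le_self_add
  · refine mul_le_mul' ?_ le_rfl
    exact add_le_add le_self_add le_rfl
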